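/- Let S be a finite set of points in a metric space, let k be a positive integer with k < |S|, and let 0 < ε ≤ 1. Suppose S = S_1 ∪ ... ∪ S_ℓ and for each i there is a nonempty subset T_i ⊆ S_i such that every s ∈ S_i satisfies d(s, T_i) ≤ ε · r_k^*(S). Let T = T_1 ∪ ... ∪ T_ℓ, assume k ≤ |T|, and let X be the set of the first k points of a greedy (GMM) sequence in T. Then r_X(S) ≤ (2 + ε) · r_k^*(S). -/

import Mathlib

/-- Distance-based radius of a finite set `S` with respect to a finite set
of centers `T`: `r_T(S) = max_{s ∈ S} d(s, T)`. -/
noncomputable def radius {α : Type*} [MetricSpace α] (S T : Finset α) : ℝ :=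
  sSup ((fun s => Metric.infDist s (T : Set α)) '' (S : Set α))

/-- Optimal radius of the `k`-center problem on `S`. -/
noncomputable def optRadius {α : Type*} [MetricSpace α] (S : Finset α) (k : ℕ) : ℝ :=
  sInf ((fun T => radius S T) '' {T : Finset α | T ⊆ S ∧ T.card = k})

/-- Optimal radius of the `k`-center problem with `z` outliers on `S`. -/
noncomputable def optRadiusOut {α : Type*} [MetricSpace α] [DecidableEq α]
    (S : Finset α) (k z : ℕ) : ℝ :=
  sInf {r : ℝ | ∃ T Z : Finset α, T ⊆ S ∧ T.card = k ∧ Z ⊆ S ∧ Z.card = z ∧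
    radius (S \ Z) T = r}

/-- `t : ℕ → α` is a greedy (GMM) sequence in the finite set `X`: `t 0 ∈ X` and
each `t (j+1)` is a point of `X` at maximum distance from `{t 0, …, t j}`. -/
def IsGMM {α : Type*} [MetricSpace α] [DecidableEq α] (X : Finset α) (t : ℕ → α) : Prop :=
  t 0 ∈ X ∧ ∀ j : ℕ, t (j + 1) ∈ X ∧ ∀ x ∈ X,
    Metric.infDist x (((Finset.range (j + 1)).image t : Finset α) : Set α) ≤
      Metric.infDist (t (j + 1)) (((Finset.range (j + 1)).image t : Finset α) : Set α)

/-- A metric space has doubling dimension at most `D` if every closed ball of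
radius `r` is covered by at most `2^D` closed balls of radius `r/2`. -/
def DoublingDimLE (α : Type*) [MetricSpace α] (D : ℕ) : Prop :=
  ∀ (x : α) (r : ℝ), 0 < r → ∃ Y : Finset α, Y.card ≤ 2 ^ D ∧
    Metric.closedBall x r ⊆ ⋃ y ∈ Y, Metric.closedBall y (r / 2)

theorem infDist_le_radius {α : Type*} [MetricSpace α] {S T : Finset α} {s : α} (hs : s ∈ S) :
    Metric.infDist s (T : Set α) ≤ radius S T :=
  le_csSup ((S.finite_toSet.image _).bddAbove) ⟨s, hs, rfl⟩

theorem radius_le {α : Type*} [MetricSpace α] {S T : Finset α} {c : ℝ} (hc : 0 ≤ c)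
    (h : ∀ s ∈ S, Metric.infDist s (T : Set α) ≤ c) : radius S T ≤ c := by
  refine Real.sSup_le ?_ hc
  rintro _ ⟨s, hs, rfl⟩
  exact h s hs

theorem radius_nonneg {α : Type*} [MetricSpace α] (S T : Finset α) : 0 ≤ radius S T := by
  refine Real.sSup_nonneg ?_
  rintro _ ⟨s, -, rfl⟩
  exact Metric.infDist_nonneg

theorem exists_radius_eq_optRadius {α : Type*} [MetricSpace α] {S : Finset α} {k : ℕ}
    (hk : k ≤ S.card) : ∃ O ⊆ S, O.card = k ∧ radius S O = optRadius S k := by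
  have hne : {T : Finset α | T ⊆ S ∧ T.card = k}.Nonempty := Finset.exists_subset_card_eq hk
  have hfin : {T : Finset α | T ⊆ S ∧ T.card = k}.Finite :=
    S.powerset.finite_toSet.subset fun T hT => by simpa using hT.1
  obtain ⟨O, ⟨hOS, hOk⟩, hO⟩ := (hne.image (radius S)).csInf_mem (hfin.image _)
  exact ⟨O, hOS, hOk, hO⟩

theorem exists_dist_eq_infDist {α : Type*} [MetricSpace α] {T : Finset α} (hT : T.Nonempty)
    (x : α) : ∃ y ∈ T, dist x y = Metric.infDist x (T : Set α) := by
  obtain ⟨y, hy, h⟩ :=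
    T.finite_toSet.isCompact.exists_infDist_eq_dist (Finset.coe_nonempty.2 hT) x
  exact ⟨y, hy, h.symm⟩

theorem IsGMM.mem {α : Type*} [MetricSpace α] [DecidableEq α] {X : Finset α} {t : ℕ → α}
    (ht : IsGMM X t) : ∀ j, t j ∈ X
  | 0 => ht.1
  | j + 1 => (ht.2 j).1

/-- The distance of any point of `X` from the first `k` greedy points is a lower bound for the
distances between these points. -/
theorem IsGMM.infDist_le_dist {α : Type*} [MetricSpace α] [DecidableEq α] {X : Finset α}
    {t : ℕ → α} (ht : IsGMM X t) {x : α} (hx : x ∈ X) {i j k : ℕ} (hij : i < j) (hjk : j < k) :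
    Metric.infDist x (((Finset.range k).image t : Finset α) : Set α) ≤ dist (t i) (t j) := by
  obtain ⟨m, rfl⟩ : ∃ m, j = m + 1 := ⟨j - 1, by omega⟩
  have hmem : t i ∈ (((Finset.range (m + 1)).image t : Finset α) : Set α) :=
    Finset.mem_coe.2 (Finset.mem_image_of_mem t (Finset.mem_range.2 hij))
  have hsub : (((Finset.range (m + 1)).image t : Finset α) : Set α) ⊆
      (((Finset.range k).image t : Finset α) : Set α) :=
    Finset.coe_subset.2 (Finset.image_subset_image (Finset.range_subset_range.2 hjk.le))
  calc _ ≤ _ := Metric.infDist_le_infDist_of_subset hsub ⟨_, hmem⟩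
    _ ≤ _ := (ht.2 m).2 x hx
    _ ≤ dist (t (m + 1)) (t i) := Metric.infDist_le_dist_of_mem hmem
    _ = _ := dist_comm _ _

/-- If `k` centers cover `X` within distance `r`, then so do the first `k` greedy points within
distance `2 * r`. -/
theorem IsGMM.infDist_le_two_mul {α : Type*} [MetricSpace α] [DecidableEq α] {X O : Finset α}
    {t : ℕ → α} (ht : IsGMM X t) {r : ℝ} (hO : ∀ x ∈ X, ∃ o ∈ O, dist x o ≤ r)
    {x : α} (hx : x ∈ X) :
    Metric.infDist x (((Finset.range O.card).image t : Finset α) : Set α) ≤ 2 * r := by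
  set k := O.card with hk
  let u : ℕ → α := fun i => if i < k then t i else x
  have hu : ∀ i, u i ∈ X := fun i => by
    by_cases hi : i < k <;> simp [u, hi, hx, ht.mem]
  have hsep : ∀ i j, i < j → j < k + 1 →
      Metric.infDist x (((Finset.range k).image t : Finset α) : Set α) ≤ dist (u i) (u j) := by
    intro i j hij hj
    have hi : i < k := by omega
    by_cases hjk : j < k
    · simpa only [u, hi, hjk, if_true] using ht.infDist_le_dist hx hij hjk
    · simp only [u, hi, hjk, if_true, if_false]
      rw [dist_comm]
      exact Metric.infDist_le_dist_of_mem
        (Finset.mem_coe.2 (Finset.mem_image_of_mem t (Finset.mem_range.2 hi)))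
  choose! f hfO hf using hO
  obtain ⟨i, hi, j, hj, hne, hij⟩ := Finset.exists_ne_map_eq_of_card_lt_of_maps_to
    (s := Finset.range (k + 1)) (t := O) (f := fun i => f (u i)) (by simp [hk])
    (fun i _ => hfO _ (hu i))
  have hdist : dist (u i) (u j) ≤ 2 * r := by
    have h₁ := hf _ (hu i)
    have h₂ := hf _ (hu j)
    have h₃ := dist_triangle_right (u i) (u j) (f (u i))
    rw [← hij] at h₂
    linarith
  rcases hne.lt_or_gt with h | h
  · exact (hsep i j h (Finset.mem_range.1 hj)).trans hdist
  · exact (hsep j i h (Finset.mem_range.1 hi)).trans (dist_comm (u i) (u j) ▸ hdist)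

/-- Theorem 3.3: if each part `S_i` of a cover of `S` has a
nonempty coreset `T_i ⊆ S_i` with `d(s, T_i) ≤ ε·r_k^*(S)` for every
`s ∈ S_i`, then running GMM for `k` steps on `T = ∪ T_i` yields a set of
centers `X` with `r_X(S) ≤ (2 + ε)·r_k^*(S)`. -/
theorem composable_coreset_two_plus_eps {α : Type*} [MetricSpace α] [DecidableEq α]
    (S : Finset α) (k : ℕ) (hk : 0 < k) (hkS : k < S.card)
    (ε : ℝ) (hε : 0 < ε) (hε1 : ε ≤ 1)
    (ℓ : ℕ) (hℓ : 0 < ℓ) (Spart Tpart : Fin ℓ → Finset α)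
    (hS : S = Finset.univ.biUnion Spart)
    (hTS : ∀ i, Tpart i ⊆ Spart i)
    (hTne : ∀ i, (Tpart i).Nonempty)
    (hprox : ∀ i, ∀ s ∈ Spart i,
      Metric.infDist s ((Tpart i : Finset α) : Set α) ≤ ε * optRadius S k)
    (T : Finset α) (hT : T = Finset.univ.biUnion Tpart) (hkT : k ≤ T.card)
    (t : ℕ → α) (ht : IsGMM T t) :
    radius S ((Finset.range k).image t) ≤ (2 + ε) * optRadius S k := by
  obtain ⟨O, -, hOk, hOr⟩ := exists_radius_eq_optRadius hkS.le
  have hr : 0 ≤ optRadius S k := hOr ▸ radius_nonneg S O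
  have hO : ∀ x ∈ T, ∃ o ∈ O, dist x o ≤ optRadius S k := by
    intro x hx
    have hxS : x ∈ S := by
      subst hS hT
      exact Finset.biUnion_mono (fun i _ => hTS i) hx
    obtain ⟨o, ho, h⟩ := exists_dist_eq_infDist (Finset.card_pos.1 (hOk ▸ hk)) x
    exact ⟨o, ho, h ▸ hOr ▸ infDist_le_radius hxS⟩
  refine radius_le (by positivity) fun s hs => ?_
  obtain ⟨i, -, hi⟩ := Finset.mem_biUnion.1 (hS ▸ hs)
  obtain ⟨y, hy, hsy⟩ := exists_dist_eq_infDist (hTne i) s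
  have hyT : y ∈ T := hT ▸ Finset.mem_biUnion.2 ⟨i, Finset.mem_univ i, hy⟩
  have hyX := ht.infDist_le_two_mul hO hyT
  rw [hOk] at hyX
  have hprox_s := hprox i s hi
  have htri := Metric.infDist_le_infDist_add_dist (x := s) (y := y)
    (s := (((Finset.range k).image t : Finset α) : Set α))
  linarith
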